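/- arXiv:2308.01768 — 2 statements merged into one kernel-verified Lean document; each statement's English description precedes it below -/
import Mathlib

section
/- For every n ≥ 1 and all a, x ∈ ℝ^n, Th(a)·x = C^{−1}·((C·Γ·a) ⊙ (C·x)), where ⊙ denotes the entrywise (Hadamard) product of vectors. -/
open Matrix

/-- The discrete cosine transform matrix `C̄ ∈ ℝ^{n×n}` with (1-based) entries
`C̄[i,j] = √((2 − δ_{i,1})/n)·cos((i−1)(2j−1)π/(2n))`. -/
noncomputable def dctBar (n : ℕ) : Matrix (Fin n) (Fin n) ℝ :=
  fun i j => Real.sqrt ((2 - if i.val = 0 then 1 else 0) / n) *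
    Real.cos ((i.val : ℝ) * (2 * (j.val : ℝ) + 1) * Real.pi / (2 * n))

/-- The vector `c₁ ∈ ℝ^n` with `c₁[i] = 1/C̄[i,1]`. -/
noncomputable def cOne (n : ℕ) (hn : 1 ≤ n) : Fin n → ℝ :=
  fun i => 1 / dctBar n i ⟨0, hn⟩

/-- The matrix `C = diag(c₁)·C̄`. -/
noncomputable def Cmat (n : ℕ) (hn : 1 ≤ n) : Matrix (Fin n) (Fin n) ℝ :=
  Matrix.diagonal (cOne n hn) * dctBar n

/-- The Toeplitz-plus-Hankel matrix `Th(a) ∈ ℝ^{n×n}` (1-based formula):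
`Th(a)[i,j] = a[|i−j|+1] + (1 − δ_{i+j,n+1})·b_{ij}`, where `b_{ij} = a[i+j]`
if `i+j ≤ n` and `b_{ij} = a[2(n+1)−(i+j)]` if `i+j > n`.
Indices `i j : Fin n` correspond to 1-based indices `i.val+1`, `j.val+1`. -/
noncomputable def thMat {n : ℕ} (a : Fin n → ℝ) : Matrix (Fin n) (Fin n) ℝ :=
  fun i j =>
    a ⟨i.val - j.val + (j.val - i.val), by have := i.isLt; have := j.isLt; omega⟩ +
    if hd : i.val + j.val + 1 = n then 0
    else if hle : i.val + j.val + 2 ≤ n then a ⟨i.val + j.val + 1, by omega⟩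
    else a ⟨2 * n - 1 - (i.val + j.val), by have := i.isLt; have := j.isLt; omega⟩

/-- The unit upper bidiagonal matrix `Γ ∈ ℝ^{n×n}` with `Γ[i,i] = 1`,
`Γ[i,i+1] = 1` for `i < n`, and all other entries `0`. -/
def gammaMat (n : ℕ) : Matrix (Fin n) (Fin n) ℝ :=
  fun i j => if j.val = i.val then 1 else if j.val = i.val + 1 then 1 else 0

/-- The unnormalized cosine matrix. -/
noncomputable def cosMat (n : ℕ) : Matrix (Fin n) (Fin n) ℝ :=
  fun k j => Real.cos ((k.val : ℝ) * (2 * (j.val : ℝ) + 1) * (Real.pi / (2 * n)))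

lemma cos_mul_pi_div_pos {n : ℕ} (k : Fin n) :
    0 < Real.cos ((k.val : ℝ) * (Real.pi / (2 * n))) := by
  have hk : (k.val : ℝ) < n := by exact_mod_cast k.isLt
  have hk0 : (0 : ℝ) ≤ k.val := Nat.cast_nonneg _
  have hn : (0 : ℝ) < n := lt_of_le_of_lt hk0 hk
  have hlt : (k.val : ℝ) * (Real.pi / (2 * n)) < Real.pi / 2 := by
    have h : Real.pi / 2 = n * (Real.pi / (2 * n)) := by field_simp
    rw [h]
    exact mul_lt_mul_of_pos_right hk (by positivity)
  have hge : 0 ≤ (k.val : ℝ) * (Real.pi / (2 * n)) := by positivity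
  exact Real.cos_pos_of_mem_Ioo ⟨by linarith [Real.pi_pos], hlt⟩

lemma Cmat_apply (n : ℕ) (hn : 1 ≤ n) (k j : Fin n) :
    Cmat n hn k j = (Real.cos ((k.val : ℝ) * (Real.pi / (2 * n))))⁻¹ * cosMat n k j := by
  have hc := (cos_mul_pi_div_pos k).ne'
  have hn0 : (0 : ℝ) < n := by exact_mod_cast hn
  have hs : Real.sqrt ((2 - if k.val = 0 then 1 else 0) / n) ≠ 0 := by
    refine (Real.sqrt_pos.2 (div_pos ?_ hn0)).ne'
    split_ifs <;> norm_num
  rw [Cmat, Matrix.diagonal_mul]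
  simp only [cOne, dctBar, cosMat, mul_div_assoc, Nat.cast_zero, mul_zero, zero_add, mul_one]
  field_simp

lemma Cmat_eq (n : ℕ) (hn : 1 ≤ n) :
    Cmat n hn =
      diagonal (fun k : Fin n => (Real.cos ((k.val : ℝ) * (Real.pi / (2 * n))))⁻¹) * cosMat n := by
  ext k j
  rw [Cmat_apply, Matrix.diagonal_mul]

lemma two_sin_mul_sum_cos_odd (t : ℝ) (n : ℕ) :
    2 * Real.sin t * ∑ j ∈ Finset.range n, Real.cos ((2 * (j : ℝ) + 1) * t) =
      Real.sin (2 * n * t) := by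
  induction n with
  | zero => simp
  | succ n ih =>
    rw [Finset.sum_range_succ, mul_add, ih]
    have h1 : 2 * (n : ℝ) * t = (2 * n + 1) * t - t := by ring
    have h2 : 2 * ((n + 1 : ℕ) : ℝ) * t = (2 * n + 1) * t + t := by push_cast; ring
    rw [h1, h2, Real.sin_add, Real.sin_sub]
    ring

lemma sum_cos_odd_mul_eq_zero {n : ℕ} (hn : 1 ≤ n) (p : ℤ) (hp : p ≠ 0) (hlt : |p| < 2 * n) :
    ∑ j : Fin n, Real.cos ((2 * (j.val : ℝ) + 1) * (p * (Real.pi / (2 * n)))) = 0 := by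
  have hn0 : (n : ℝ) ≠ 0 := by positivity
  have h := two_sin_mul_sum_cos_odd (p * (Real.pi / (2 * n))) n
  have hr : 2 * (n : ℝ) * (p * (Real.pi / (2 * n))) = p * Real.pi := by field_simp
  rw [hr, Real.sin_int_mul_pi] at h
  rw [Fin.sum_univ_eq_sum_range
    (fun j : ℕ => Real.cos ((2 * (j : ℝ) + 1) * (p * (Real.pi / (2 * n)))))]
  refine (mul_eq_zero.1 h).resolve_left (mul_ne_zero two_ne_zero fun hs => hp ?_)
  obtain ⟨m, hm⟩ := Real.sin_eq_zero_iff.1 hs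
  have hpm : p = 2 * n * m := by
    have : (p : ℝ) = 2 * n * m := by
      have hpi := Real.pi_ne_zero
      field_simp at hm
      linarith
    exact_mod_cast this
  exact Int.eq_zero_of_abs_lt_dvd ⟨m, hpm⟩ hlt

lemma cosMat_mul_transpose {n : ℕ} (hn : 1 ≤ n) :
    cosMat n * (cosMat n)ᵀ = diagonal fun k => ∑ j, cosMat n k j ^ 2 := by
  ext k l
  rw [Matrix.mul_apply]
  rcases eq_or_ne k l with rfl | hkl
  · simp [sq]
  rw [Matrix.diagonal_apply_ne _ hkl]
  have hv : k.val ≠ l.val := fun h => hkl (Fin.ext h)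
  have hk := k.isLt
  have hl := l.isLt
  have h1 := sum_cos_odd_mul_eq_zero hn ((k.val : ℤ) - l.val) (by omega)
    (by rw [abs_lt]; omega)
  have h2 := sum_cos_odd_mul_eq_zero hn ((k.val : ℤ) + l.val) (by omega)
    (by rw [abs_lt]; omega)
  have h3 : ∑ j, 2 * (cosMat n k j * (cosMat n)ᵀ j l) = 0 := by
    refine Eq.trans ?_ ((congrArg₂ (· + ·) h1 h2).trans (add_zero 0))
    rw [← Finset.sum_add_distrib]
    refine Finset.sum_congr rfl fun j _ => ?_
    rw [Matrix.transpose_apply, cosMat, cosMat, ← mul_assoc, Real.two_mul_cos_mul_cos]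
    push_cast
    congr 2 <;> ring
  rw [← Finset.mul_sum] at h3
  linarith

lemma isUnit_det_Cmat (n : ℕ) (hn : 1 ≤ n) : IsUnit (Cmat n hn).det := by
  rw [isUnit_iff_ne_zero, Cmat_eq, Matrix.det_mul, Matrix.det_diagonal]
  refine mul_ne_zero (Finset.prod_ne_zero_iff.2 fun k _ =>
    inv_ne_zero (cos_mul_pi_div_pos k).ne') fun h => ?_
  have hdet := congrArg Matrix.det (cosMat_mul_transpose hn)
  rw [Matrix.det_mul, h, zero_mul, Matrix.det_diagonal, eq_comm] at hdet
  refine Finset.prod_ne_zero_iff.2 (fun k _ => ?_) hdet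
  refine (Finset.sum_pos' (fun j _ => sq_nonneg _) ⟨⟨0, hn⟩, Finset.mem_univ _, ?_⟩).ne'
  have := cos_mul_pi_div_pos k
  simp only [cosMat, Nat.cast_zero, mul_zero, zero_add, mul_one]
  positivity

lemma thMat_apply_eq_sum {n : ℕ} (a : Fin n → ℝ) (i j : Fin n) :
    thMat a i j = ∑ m : Fin n, a m *
      ((if m.val = i.val - j.val + (j.val - i.val) then 1 else 0) +
        ((if m.val = i.val + j.val + 1 then 1 else 0) +
          (if m.val + i.val + j.val + 1 = 2 * n then 1 else 0))) := by
  have hi := i.isLt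
  have hj := j.isLt
  have key (p : ℕ) (hp : p < n) : a ⟨p, hp⟩ = ∑ m : Fin n, a m * (if m.val = p then 1 else 0) := by
    rw [Finset.sum_eq_single ⟨p, hp⟩]
    · simp
    · intro m _ hm
      rw [if_neg fun h => hm (Fin.ext h), mul_zero]
    · simp
  simp only [mul_add (a _), Finset.sum_add_distrib, thMat]
  congr 1
  · exact key _ _
  rw [← Finset.sum_add_distrib]
  split_ifs with hd hle
  · refine (Finset.sum_eq_zero fun m _ => ?_).symm
    have hm := m.isLt
    rw [if_neg (by omega), if_neg (by omega)]
    ring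
  · rw [key]
    refine Finset.sum_congr rfl fun m _ => ?_
    have hm := m.isLt
    rw [if_neg (show ¬ m.val + i.val + j.val + 1 = 2 * n by omega)]
    ring
  · rw [key]
    refine Finset.sum_congr rfl fun m _ => ?_
    have hm := m.isLt
    rw [if_neg (show ¬ m.val = i.val + j.val + 1 by omega), mul_zero, zero_add]
    congr 2
    apply propext
    omega

lemma sum_mul_ite_eq {n : ℕ} (f : Fin n → ℝ) (P : ℕ → Prop) [DecidablePred P] (p : Fin n)
    (h : ∀ i < n, P i ↔ i = p.val) : ∑ i : Fin n, f i * (if P i.val then 1 else 0) = f p := by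
  rw [Finset.sum_eq_single p]
  · rw [if_pos ((h _ p.isLt).2 rfl), mul_one]
  · intro i _ hi
    rw [if_neg fun hP => hi (Fin.ext ((h _ i.isLt).1 hP)), mul_zero]
  · simp

/-- Each row of the cosine matrix is a left eigenvector of the Toeplitz-plus-Hankel matrix of a
standard basis vector. -/
lemma sum_cosMat_mul_basis {n : ℕ} (k m j : Fin n) :
    ∑ i : Fin n, cosMat n k i *
      ((if m.val = i.val - j.val + (j.val - i.val) then 1 else 0) +
        ((if m.val = i.val + j.val + 1 then 1 else 0) +
          (if m.val + i.val + j.val + 1 = 2 * n then 1 else 0))) =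
      (if m.val = 0 then 1 else 2 * Real.cos (2 * k.val * m.val * (Real.pi / (2 * n)))) *
        cosMat n k j := by
  have hm := m.isLt
  have hj := j.isLt
  have hn : (n : ℝ) ≠ 0 := by
    have : 0 < n := by omega
    positivity
  split_ifs with h0
  · rw [one_mul, ← sum_mul_ite_eq (cosMat n k) (fun i => i = j.val) j (fun i _ => Iff.rfl)]
    refine Finset.sum_congr rfl fun i _ => ?_
    have hi := i.isLt
    rw [if_neg (show ¬ m.val = i.val + j.val + 1 by omega),
      if_neg (show ¬ m.val + i.val + j.val + 1 = 2 * n by omega), add_zero, add_zero]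
    congr 2
    apply propext
    omega
  have hlow : ∑ i : Fin n, cosMat n k i *
      (if i.val + m.val = j.val ∨ m.val = i.val + j.val + 1 then 1 else 0) =
      Real.cos (k.val * (2 * ((j.val : ℝ) - m.val) + 1) * (Real.pi / (2 * n))) := by
    by_cases hmj : m.val ≤ j.val
    · rw [sum_mul_ite_eq (cosMat n k)
        (fun i => i + m.val = j.val ∨ m.val = i + j.val + 1) ⟨j.val - m.val, by omega⟩
        (fun i _ => by simp only; omega), cosMat]
      simp only [Nat.cast_sub hmj]
    · rw [sum_mul_ite_eq (cosMat n k)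
        (fun i => i + m.val = j.val ∨ m.val = i + j.val + 1) ⟨m.val - (j.val + 1), by omega⟩
        (fun i _ => by simp only; omega), cosMat]
      simp only [Nat.cast_sub (show j.val + 1 ≤ m.val by omega)]
      rw [← Real.cos_neg]
      congr 1
      push_cast
      ring
  have hhigh : ∑ i : Fin n, cosMat n k i *
      (if i.val = j.val + m.val ∨ m.val + i.val + j.val + 1 = 2 * n then 1 else 0) =
      Real.cos (k.val * (2 * ((j.val : ℝ) + m.val) + 1) * (Real.pi / (2 * n))) := by
    by_cases hmj : j.val + m.val < n
    · rw [sum_mul_ite_eq (cosMat n k)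
        (fun i => i = j.val + m.val ∨ m.val + i + j.val + 1 = 2 * n) ⟨j.val + m.val, hmj⟩
        (fun i _ => by simp only; omega), cosMat]
      simp only [Nat.cast_add]
    · rw [sum_mul_ite_eq (cosMat n k)
        (fun i => i = j.val + m.val ∨ m.val + i + j.val + 1 = 2 * n)
        ⟨2 * n - (m.val + j.val + 1), by omega⟩
        (fun i _ => by simp only; omega), cosMat]
      simp only [Nat.cast_sub (show m.val + j.val + 1 ≤ 2 * n by omega)]
      rw [← Real.cos_nat_mul_two_pi_sub _ k.val]
      congr 1
      push_cast
      field_simp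
      ring
  calc _ = ∑ i : Fin n, cosMat n k i *
        (if i.val + m.val = j.val ∨ m.val = i.val + j.val + 1 then 1 else 0) +
      ∑ i : Fin n, cosMat n k i *
        (if i.val = j.val + m.val ∨ m.val + i.val + j.val + 1 = 2 * n then 1 else 0) := by
        rw [← Finset.sum_add_distrib]
        refine Finset.sum_congr rfl fun i _ => ?_
        rw [← mul_add]
        congr 1
        have hi := i.isLt
        split_ifs <;> first | omega | norm_num
    _ = _ := by
        rw [hlow, hhigh, cosMat, Real.two_mul_cos_mul_cos, ← Real.cos_neg (_ - _)]
        congr 2 <;> ring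

lemma Cmat_mulVec_gammaMat_mulVec {n : ℕ} (hn : 1 ≤ n) (a : Fin n → ℝ) (k : Fin n) :
    (Cmat n hn *ᵥ (gammaMat n *ᵥ a)) k =
      ∑ m : Fin n, a m *
        (if m.val = 0 then 1 else 2 * Real.cos (2 * k.val * m.val * (Real.pi / (2 * n)))) := by
  rw [Matrix.mulVec_mulVec, Matrix.mulVec, dotProduct]
  refine Finset.sum_congr rfl fun m _ => ?_
  rw [mul_comm, Matrix.mul_apply]
  congr 1
  have hm := m.isLt
  have hc := (cos_mul_pi_div_pos k).ne'
  simp only [Cmat_apply, mul_assoc _ (cosMat n k _)]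
  rw [← Finset.mul_sum, inv_mul_eq_iff_eq_mul₀ hc]
  split_ifs with h0
  · have h : ∀ i : Fin n, gammaMat n i m = if i.val = m.val then 1 else 0 := by
      intro i
      simp only [gammaMat]
      split_ifs <;> first | omega | rfl
    simp only [h]
    rw [sum_mul_ite_eq (cosMat n k) (fun i => i = m.val) m (fun i _ => Iff.rfl), cosMat]
    simp [h0]
  · have h : ∀ i : Fin n, gammaMat n i m =
        (if i.val = m.val then 1 else 0) + (if i.val + 1 = m.val then 1 else 0) := by
      intro i
      simp only [gammaMat]
      split_ifs <;> first | omega | norm_num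
    simp only [h, mul_add, Finset.sum_add_distrib]
    rw [sum_mul_ite_eq (cosMat n k) (fun i => i = m.val) m (fun i _ => Iff.rfl),
      sum_mul_ite_eq (cosMat n k) (fun i => i + 1 = m.val) ⟨m.val - 1, by omega⟩
        (fun i _ => by simp only; omega)]
    simp only [cosMat, Nat.cast_sub (show 1 ≤ m.val by omega)]
    have htwo := Real.two_mul_cos_mul_cos (2 * k.val * m.val * (Real.pi / (2 * n)))
      (k.val * (Real.pi / (2 * n)))
    rw [mul_comm (Real.cos _) (2 * _), htwo, add_comm]
    push_cast
    congr 2 <;> ring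

lemma Cmat_mul_thMat {n : ℕ} (hn : 1 ≤ n) (a : Fin n → ℝ) :
    Cmat n hn * thMat a = diagonal (Cmat n hn *ᵥ (gammaMat n *ᵥ a)) * Cmat n hn := by
  ext k j
  rw [Matrix.diagonal_mul, Cmat_mulVec_gammaMat_mulVec, Matrix.mul_apply]
  simp only [Cmat_apply, thMat_apply_eq_sum, mul_assoc _ (cosMat n k _)]
  rw [← Finset.mul_sum, mul_left_comm, Finset.sum_mul]
  congr 1
  simp only [Finset.mul_sum]
  rw [Finset.sum_comm]
  refine Finset.sum_congr rfl fun m _ => ?_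
  rw [mul_assoc, ← sum_cosMat_mul_basis, Finset.mul_sum]
  exact Finset.sum_congr rfl fun i _ => mul_left_comm _ _ _

/-- For every `n ≥ 1` and all `a, x ∈ ℝ^n`,
`Th(a)·x = C⁻¹·((C·Γ·a) ⊙ (C·x))`, where `⊙` is the entrywise (Hadamard) product. -/
theorem thMat_mulVec_eq_cosine (n : ℕ) (hn : 1 ≤ n) (a x : Fin n → ℝ) :
    thMat a *ᵥ x =
      (Cmat n hn)⁻¹ *ᵥ
        (fun i => (Cmat n hn *ᵥ (gammaMat n *ᵥ a)) i * (Cmat n hn *ᵥ x) i) := by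
  have h : (fun i => (Cmat n hn *ᵥ (gammaMat n *ᵥ a)) i * (Cmat n hn *ᵥ x) i) =
      Cmat n hn *ᵥ (thMat a *ᵥ x) := by
    rw [Matrix.mulVec_mulVec x, Cmat_mul_thMat, ← Matrix.mulVec_mulVec]
    ext i
    rw [Matrix.mulVec_diagonal]
  rw [h, Matrix.mulVec_mulVec, Matrix.nonsing_inv_mul _ (isUnit_det_Cmat n hn),
    Matrix.one_mulVec]
end

section
/- The ⋆_c-product of 4-order tensors (block convolution with reflective boundary conditions in modes 2 and 3) is computed slice-wise in the cosine domain: let A ∈ ℝ^{I1×I2×I3×J}, X ∈ ℝ^{J×I2×I3×I5}, and Y = A ⋆_c X. Let Ā, X̄, Ȳ be obtained by applying C (of sizes I2 and I3) along modes 2 and 3 of A, X, Y respectively. Then for all i2 ∈ {1,…,I2} and i3 ∈ {1,…,I3}, Ȳ[:,i2,i3,:] = Ā[:,i2,i3,:]·X̄[:,i2,i3,:] (a matrix product). -/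
open Matrix

/-- The reflective extension `x̃ : ℤ → ℝ` of `x ∈ ℝ^n` (indices are 1-based):
`x̃_j = x_j` for `1 ≤ j ≤ n`, `x̃_j = x_{1−j}` for `1−n ≤ j ≤ 0`,
`x̃_j = x_{2n+1−j}` for `n+1 ≤ j ≤ 2n`, and `0` outside this range. -/
noncomputable def reflGet {n : ℕ} (x : Fin n → ℝ) (j : ℤ) : ℝ :=
  if h : 1 ≤ j ∧ j ≤ (n : ℤ) then x ⟨(j - 1).toNat, by omega⟩
  else if h : 1 - (n : ℤ) ≤ j ∧ j ≤ 0 then x ⟨(-j).toNat, by omega⟩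
  else if h : (n : ℤ) + 1 ≤ j ∧ j ≤ 2 * n then x ⟨(2 * n - j).toNat, by omega⟩
  else 0

/-- Entry access with 0 outside bounds (used for the `|i−j|+1` indexing, which
always stays in range over the summation ranges below). -/
noncomputable def getN {I : ℕ} (v : Fin I → ℝ) (k : ℕ) : ℝ :=
  if h : k < I then v ⟨k, h⟩ else 0

/-- Applying matrices `M₂, M₃` along modes 2 and 3 of a 4-order tensor. -/
noncomputable def mode23 {I1 I2 I3 J : ℕ}
    (M2 : Matrix (Fin I2) (Fin I2) ℝ) (M3 : Matrix (Fin I3) (Fin I3) ℝ)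
    (T : Fin I1 → Fin I2 → Fin I3 → Fin J → ℝ) :
    Fin I1 → Fin I2 → Fin I3 → Fin J → ℝ :=
  fun i1 k2 k3 l => ∑ m2 : Fin I2, ∑ m3 : Fin I3, M2 k2 m2 * M3 k3 m3 * T i1 m2 m3 l

/-- The `⋆_c`-product of 4-order tensors (block convolution with reflective
boundary conditions in modes 2 and 3): with `Â` obtained by applying `Γ⁻¹`
along modes 2 and 3 of `A` and `X̃` the reflective extension of `X` in modes
2 and 3,
`Y[:,i2,i3,:] = Σ_{j2=i2−I2+1}^{i2+I2−1} Σ_{j3=i3−I3+1}^{i3+I3−1}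
   Â[:,|i2−j2|+1,|i3−j3|+1,:]·X̃[:,j2,j3,:]`
(indices `i2, i3` are 1-based, realized as `i2.val+1`, `i3.val+1`). -/
noncomputable def starc4 {I1 I2 I3 J I5 : ℕ}
    (A : Fin I1 → Fin I2 → Fin I3 → Fin J → ℝ)
    (X : Fin J → Fin I2 → Fin I3 → Fin I5 → ℝ) :
    Fin I1 → Fin I2 → Fin I3 → Fin I5 → ℝ :=
  fun i1 i2 i3 i5 =>
    ∑ j2 ∈ Finset.Icc (((i2.val : ℤ) + 1) - I2 + 1) (((i2.val : ℤ) + 1) + I2 - 1),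
    ∑ j3 ∈ Finset.Icc (((i3.val : ℤ) + 1) - I3 + 1) (((i3.val : ℤ) + 1) + I3 - 1),
    ∑ l : Fin J,
      getN (fun k2 => getN (fun k3 =>
            mode23 (gammaMat I2)⁻¹ (gammaMat I3)⁻¹ A i1 k2 k3 l)
          ((((i3.val : ℤ) + 1) - j3).natAbs)) ((((i2.val : ℤ) + 1) - j2).natAbs) *
      reflGet (fun k2 => reflGet (fun k3 => X l k2 k3 i5) j3) j2

theorem sum_Icc_neg_natCast (F : ℤ → ℝ) (N : ℕ) :
    ∑ e ∈ Finset.Icc (-(N : ℤ)) N, F e =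
      F 0 + ∑ d ∈ Finset.range N, (F ((d : ℤ) + 1) + F (-((d : ℤ) + 1))) := by
  induction N with
  | zero => simp
  | succ N ih =>
    have h : Finset.Icc (-((N + 1 : ℕ) : ℤ)) (N + 1 : ℕ) =
        insert ((N : ℤ) + 1) (insert (-((N : ℤ) + 1)) (Finset.Icc (-(N : ℤ)) N)) := by
      ext e
      simp only [Finset.mem_insert, Finset.mem_Icc]
      omega
    rw [h, Finset.sum_insert, Finset.sum_insert, ih, Finset.sum_range_succ]
    · ring
    · simp
    · simp only [Finset.mem_insert, Finset.mem_Icc]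
      omega

theorem Function.Periodic.sum_range_add {h : ℤ → ℝ} {N : ℕ}
    (hp : Function.Periodic h (N : ℤ)) (e : ℕ) :
    ∑ i ∈ Finset.range N, h ((i : ℤ) + e) = ∑ i ∈ Finset.range N, h i := by
  induction e with
  | zero => simp
  | succ e ih =>
    rw [← ih]
    have h1 := Finset.sum_range_succ (fun i : ℕ => h ((i : ℤ) + e)) N
    have h2 := Finset.sum_range_succ' (fun i : ℕ => h ((i : ℤ) + e)) N
    have h3 : h ((N : ℤ) + e) = h e := by rw [add_comm, hp]
    have h4 : ∑ i ∈ Finset.range N, h (((i + 1 : ℕ) : ℤ) + e) =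
        ∑ i ∈ Finset.range N, h ((i : ℤ) + (e + 1 : ℕ)) :=
      Finset.sum_congr rfl fun i _ => by
        congr 1
        push_cast
        ring
    simp only [Nat.cast_zero, zero_add] at h2
    linarith

theorem sum_range_two_mul_of_reflect {h : ℤ → ℝ} {n : ℕ}
    (hr : ∀ p, h (2 * n - 1 - p) = h p) :
    ∑ i ∈ Finset.range (2 * n), h i = 2 * ∑ i ∈ Finset.range n, h i := by
  rw [two_mul n, Finset.sum_range_add, two_mul]
  congr 1
  rw [← Finset.sum_range_reflect]
  refine Finset.sum_congr rfl fun i hi => ?_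
  rw [← hr i]
  congr 1
  have := Finset.mem_range.1 hi
  omega

/-- Symmetric shifts are self-adjoint on sequences with reflective boundary conditions. -/
theorem sum_mul_symm_shift {c f : ℤ → ℝ} {n : ℕ}
    (hc : ∀ p, c (2 * n - 1 - p) = c p) (hcp : Function.Periodic c ((2 * n : ℕ) : ℤ))
    (hf : ∀ p, f (2 * n - 1 - p) = f p) (hfp : Function.Periodic f ((2 * n : ℕ) : ℤ)) (e : ℕ) :
    ∑ i ∈ Finset.range n, c i * (f ((i : ℤ) - e) + f ((i : ℤ) + e)) =
      ∑ i ∈ Finset.range n, (c ((i : ℤ) - e) + c ((i : ℤ) + e)) * f i := by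
  have hs {g : ℤ → ℝ} (hg : ∀ p, g (2 * n - 1 - p) = g p) (p : ℤ) :
      g (2 * n - 1 - p - e) + g (2 * n - 1 - p + e) = g (p - e) + g (p + e) := by
    rw [← hg (p - e), ← hg (p + e), add_comm]
    congr 2 <;> ring
  have shift {u v : ℤ → ℝ} (hu : Function.Periodic u ((2 * n : ℕ) : ℤ))
      (hv : Function.Periodic v ((2 * n : ℕ) : ℤ)) :
      ∑ i ∈ Finset.range (2 * n), u i * v ((i : ℤ) - e) =
        ∑ i ∈ Finset.range (2 * n), u ((i : ℤ) + e) * v i := by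
    have hp : Function.Periodic (fun p : ℤ => u p * v (p - e)) ((2 * n : ℕ) : ℤ) := fun p => by
      simp only
      rw [hu, show p + ((2 * n : ℕ) : ℤ) - e = p - e + ((2 * n : ℕ) : ℤ) by ring, hv]
    rw [← hp.sum_range_add e]
    simp
  have h1 := sum_range_two_mul_of_reflect (n := n)
    (h := fun p => c p * (f (p - e) + f (p + e))) fun p => by simp only [hc, hs hf]
  have h2 := sum_range_two_mul_of_reflect (n := n)
    (h := fun p => (c (p - e) + c (p + e)) * f p) fun p => by simp only [hf, hs hc]
  have h3 := shift hcp hfp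
  have h4 := shift hfp hcp
  simp only [mul_comm (f _)] at h4
  simp only [mul_add, add_mul, Finset.sum_add_distrib] at h1 h2 ⊢
  linarith

/-- The `2n`-periodic even extension of `x ∈ ℝ^n`, with 0-based indices. -/
noncomputable def evenExt {n : ℕ} (x : Fin n → ℝ) (p : ℤ) : ℝ :=
  if p % (2 * n : ℕ) < n then getN x (p % (2 * n : ℕ)).toNat
  else getN x (2 * n - 1 - p % (2 * n : ℕ)).toNat

theorem evenExt_periodic {n : ℕ} (x : Fin n → ℝ) :
    Function.Periodic (evenExt x) ((2 * n : ℕ) : ℤ) := fun p => by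
  simp only [evenExt, Int.add_emod_right]

theorem evenExt_reflect {n : ℕ} (hn : 1 ≤ n) (x : Fin n → ℝ) (p : ℤ) :
    evenExt x (2 * n - 1 - p) = evenExt x p := by
  have hr0 := Int.emod_nonneg p (b := ((2 * n : ℕ) : ℤ)) (by omega)
  have hr1 := Int.emod_lt_of_pos p (b := ((2 * n : ℕ) : ℤ)) (by omega)
  have hm : (2 * n - 1 - p) % ((2 * n : ℕ) : ℤ) = 2 * n - 1 - p % ((2 * n : ℕ) : ℤ) := by
    have hd := Int.emod_add_mul_ediv p ((2 * n : ℕ) : ℤ)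
    rw [show (2 * n - 1 - p : ℤ) = (2 * n - 1 - p % ((2 * n : ℕ) : ℤ)) +
      ((2 * n : ℕ) : ℤ) * (-(p / ((2 * n : ℕ) : ℤ))) by linear_combination hd,
      Int.add_mul_emod_self_left, Int.emod_eq_of_lt] <;> omega
  unfold evenExt
  rw [hm]
  split_ifs
  · omega
  · rfl
  · congr 2
    ring
  · omega

theorem reflGet_eq_evenExt {n : ℕ} (x : Fin n → ℝ) {p : ℤ} (h0 : -n ≤ p) (h1 : p < 2 * n) :
    reflGet x (p + 1) = evenExt x p := by
  unfold reflGet evenExt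
  rcases lt_or_ge p 0 with hp | hp
  · have hm : p % ((2 * n : ℕ) : ℤ) = p + (2 * n : ℕ) := by
      rw [← Int.add_emod_right, Int.emod_eq_of_lt] <;> omega
    rw [hm, dif_neg (by omega), dif_pos (by omega), if_neg (by omega), getN, dif_pos (by omega)]
    congr 2
    omega
  · have hm : p % ((2 * n : ℕ) : ℤ) = p := Int.emod_eq_of_lt hp (by omega)
    rw [hm]
    by_cases hpn : p < n
    · rw [dif_pos (by omega), if_pos hpn, getN, dif_pos (by omega)]
      congr 2
      omega
    · rw [dif_neg (by omega), dif_neg (by omega), dif_pos (by omega), if_neg hpn, getN,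
        dif_pos (by omega)]
      congr 2
      omega

theorem getN_sum {ι : Type*} {I : ℕ} (s : Finset ι) (w : ι → ℝ) (v : ι → Fin I → ℝ) (k : ℕ) :
    getN (fun m => ∑ i ∈ s, w i * v i m) k = ∑ i ∈ s, w i * getN (v i) k := by
  unfold getN
  split_ifs <;> simp

theorem reflGet_sum {ι : Type*} {n : ℕ} (s : Finset ι) (w : ι → ℝ) (v : ι → Fin n → ℝ) (j : ℤ) :
    reflGet (fun m => ∑ i ∈ s, w i * v i m) j = ∑ i ∈ s, w i * reflGet (v i) j := by
  unfold reflGet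
  split_ifs <;> simp

/-- The normalized cosine `cos(k(2p+1)π/(2n)) / cos(kπ/(2n))`. -/
noncomputable def cosRatio (n k : ℕ) (p : ℤ) : ℝ :=
  Real.cos (k * (2 * p + 1) * Real.pi / (2 * n)) / Real.cos (k * Real.pi / (2 * n))

theorem cos_ne_zero_of_lt {n k : ℕ} (hk : k < n) : Real.cos (k * Real.pi / (2 * n)) ≠ 0 := by
  have hn : (0 : ℝ) < n := by exact_mod_cast (Nat.zero_le k).trans_lt hk
  have hkn : (k : ℝ) < n := by exact_mod_cast hk
  refine (Real.cos_pos_of_mem_Ioo ⟨?_, ?_⟩).ne'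
  · have : (0 : ℝ) ≤ k * Real.pi / (2 * n) := by positivity
    linarith [Real.pi_pos]
  · rw [div_lt_div_iff₀ (by positivity) two_pos]
    nlinarith [Real.pi_pos]

theorem Cmat_apply_s14 {n : ℕ} (hn : 1 ≤ n) (k j : Fin n) :
    Cmat n hn k j = cosRatio n k j := by
  have hn' : (0 : ℝ) < n := by exact_mod_cast hn
  have hs : Real.sqrt ((2 - if k.val = 0 then 1 else 0) / n) ≠ 0 := by
    refine (Real.sqrt_pos.2 (div_pos ?_ hn')).ne'
    split_ifs <;> norm_num
  have hc := cos_ne_zero_of_lt k.isLt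
  simp only [Cmat, Matrix.diagonal_mul, cOne, dctBar, cosRatio, Nat.cast_zero, mul_zero, zero_add,
    mul_one, Int.cast_natCast]
  field_simp

theorem cosRatio_periodic (n k : ℕ) (hn : 1 ≤ n) :
    Function.Periodic (cosRatio n k) ((2 * n : ℕ) : ℤ) := fun p => by
  have hn' : (n : ℝ) ≠ 0 := by positivity
  unfold cosRatio
  congr 1
  rw [← Real.cos_add_nat_mul_two_pi (k * (2 * p + 1) * Real.pi / (2 * n)) k]
  congr 1
  push_cast
  field_simp
  ring

theorem cosRatio_reflect (n k : ℕ) (hn : 1 ≤ n) (p : ℤ) :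
    cosRatio n k (2 * n - 1 - p) = cosRatio n k p := by
  have hn' : (n : ℝ) ≠ 0 := by positivity
  unfold cosRatio
  congr 1
  rw [← Real.cos_nat_mul_two_pi_sub _ k]
  congr 1
  push_cast
  field_simp
  ring

theorem cosRatio_sub_add_cosRatio_add (n k : ℕ) (p e : ℤ) :
    cosRatio n k (p - e) + cosRatio n k (p + e) =
      2 * Real.cos (2 * k * e * Real.pi / (2 * n)) * cosRatio n k p := by
  unfold cosRatio
  rw [← add_div, ← mul_div_assoc]
  congr 1
  have h (x y : ℝ) : Real.cos (x - y) + Real.cos (x + y) = 2 * Real.cos y * Real.cos x := by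
    rw [Real.cos_sub, Real.cos_add]
    ring
  rw [← h]
  congr 2 <;> (push_cast; ring)

theorem cosRatio_zero {n k : ℕ} (hk : k < n) : cosRatio n k 0 = 1 := by
  simp [cosRatio, cos_ne_zero_of_lt hk]

theorem cosRatio_add_cosRatio_succ {n k : ℕ} (hk : k < n) (d : ℤ) :
    cosRatio n k d + cosRatio n k (d + 1) =
      2 * Real.cos (2 * k * (d + 1) * Real.pi / (2 * n)) := by
  have hc := cos_ne_zero_of_lt hk
  unfold cosRatio
  rw [← add_div, div_eq_iff hc]
  have h (x y : ℝ) : Real.cos (x - y) + Real.cos (x + y) = 2 * Real.cos x * Real.cos y := by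
    rw [Real.cos_sub, Real.cos_add]
    ring
  rw [← h]
  congr 2 <;> (push_cast; ring)

theorem Cmat_mul_gammaMat_zero {N : ℕ} (hn : 1 ≤ N + 1) (k : Fin (N + 1)) :
    (Cmat (N + 1) hn * gammaMat (N + 1)) k 0 = 1 := by
  rw [Matrix.mul_apply, Finset.sum_eq_single 0]
  · simp [Cmat_apply_s14, gammaMat, cosRatio_zero k.isLt]
  · intro e _ he
    have : (0 : ℕ) ≠ e.val := fun h => he (Fin.ext h.symm)
    simp [gammaMat, this]
  · simp

theorem Cmat_mul_gammaMat_succ {N : ℕ} (hn : 1 ≤ N + 1) (k : Fin (N + 1)) (d : Fin N) :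
    (Cmat (N + 1) hn * gammaMat (N + 1)) k d.succ =
      2 * Real.cos (2 * k * (d + 1) * Real.pi / (2 * (N + 1 : ℕ))) := by
  have hg (e : Fin (N + 1)) : gammaMat (N + 1) e d.succ =
      (if e = d.castSucc then 1 else 0) + (if e = d.succ then 1 else 0) := by
    simp only [gammaMat, Fin.ext_iff, Fin.val_succ, Fin.val_castSucc]
    split_ifs <;> first | omega | simp
  have h := cosRatio_add_cosRatio_succ k.isLt d
  rw [Int.cast_natCast] at h
  rw [← h]
  simp only [Matrix.mul_apply, hg, mul_add, mul_ite, mul_one, mul_zero, Finset.sum_add_distrib,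
    Finset.sum_ite_eq', Finset.mem_univ, if_true, Cmat_apply_s14, Fin.val_succ, Fin.val_castSucc]
  push_cast
  rfl

theorem sum_Icc_mul_reflect (G H : ℤ → ℝ) (N : ℕ) (q : ℤ) :
    ∑ j ∈ Finset.Icc (q - (N + 1 : ℕ) + 1) (q + (N + 1 : ℕ) - 1), G (q - j) * H j =
      ∑ e ∈ Finset.Icc (-(N : ℤ)) N, G e * H (q - e) := by
  refine Finset.sum_nbij' (fun j => q - j) (fun e => q - e) ?_ ?_ ?_ ?_ ?_ <;>
    intro j hj <;> simp only [Finset.mem_Icc, sub_sub_cancel] at hj ⊢ <;> omega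

theorem Cmat_reflConv {n : ℕ} (hn : 1 ≤ n) (a x : Fin n → ℝ) (k : Fin n) :
    ∑ i : Fin n, Cmat n hn k i *
        ∑ j ∈ Finset.Icc (((i.val : ℤ) + 1) - n + 1) (((i.val : ℤ) + 1) + n - 1),
          getN a (((i.val : ℤ) + 1) - j).natAbs * reflGet x j =
      (∑ d, (Cmat n hn * gammaMat n) k d * a d) * ∑ m, Cmat n hn k m * x m := by
  obtain ⟨N, rfl⟩ := Nat.exists_eq_add_of_le' hn
  have hx (m : Fin (N + 1)) : x m = evenExt x m := by
    rw [← reflGet_eq_evenExt x (by omega) (by omega), reflGet, dif_pos (by omega)]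
    congr 1
    ext
    simp
  have key (e : ℕ) : ∑ i : Fin (N + 1), Cmat (N + 1) hn k i *
      (evenExt x ((i.val : ℤ) - e) + evenExt x ((i.val : ℤ) + e)) =
      2 * Real.cos (2 * k * e * Real.pi / (2 * (N + 1 : ℕ))) *
        ∑ m, Cmat (N + 1) hn k m * x m := by
    simp only [Cmat_apply_s14, hx]
    rw [Fin.sum_univ_eq_sum_range (fun i : ℕ => cosRatio (N + 1) k i *
      (evenExt x ((i : ℤ) - e) + evenExt x ((i : ℤ) + e))),
      sum_mul_symm_shift (cosRatio_reflect _ _ hn) (cosRatio_periodic _ _ hn)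
        (evenExt_reflect hn x) (evenExt_periodic x), Finset.mul_sum,
      Fin.sum_univ_eq_sum_range (fun i : ℕ => 2 *
        Real.cos (2 * k * e * Real.pi / (2 * (N + 1 : ℕ))) *
        (cosRatio (N + 1) k i * evenExt x i))]
    refine Finset.sum_congr rfl fun i _ => ?_
    rw [cosRatio_sub_add_cosRatio_add, Int.cast_natCast, mul_assoc]
  have inner (i : Fin (N + 1)) :
      ∑ j ∈ Finset.Icc (((i.val : ℤ) + 1) - (N + 1 : ℕ) + 1)
          (((i.val : ℤ) + 1) + (N + 1 : ℕ) - 1),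
          getN a (((i.val : ℤ) + 1) - j).natAbs * reflGet x j =
        a 0 * x i + ∑ d : Fin N, a d.succ *
          (evenExt x ((i.val : ℤ) - (d.val + 1 : ℕ)) +
            evenExt x ((i.val : ℤ) + (d.val + 1 : ℕ))) := by
    rw [sum_Icc_mul_reflect (fun e => getN a e.natAbs) (reflGet x), sum_Icc_neg_natCast,
      ← Fin.sum_univ_eq_sum_range (fun d : ℕ => getN a ((d : ℤ) + 1).natAbs *
        reflGet x ((i.val : ℤ) + 1 - ((d : ℤ) + 1)) + getN a (-((d : ℤ) + 1)).natAbs *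
        reflGet x ((i.val : ℤ) + 1 - (-((d : ℤ) + 1))))]
    congr 1
    · rw [hx, sub_zero, reflGet_eq_evenExt x (by omega) (by omega)]
      simp [getN]
    · refine Finset.sum_congr rfl fun d _ => ?_
      have ha : getN a ((d.val : ℤ) + 1).natAbs = a d.succ := by
        rw [getN, dif_pos (by omega)]
        congr 1
      rw [Int.natAbs_neg, ha, ← mul_add,
        ← reflGet_eq_evenExt x (p := (i.val : ℤ) - (d.val + 1 : ℕ)) (by omega) (by omega),
        ← reflGet_eq_evenExt x (p := (i.val : ℤ) + (d.val + 1 : ℕ)) (by omega) (by omega)]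
      congr 3 <;> (push_cast; ring)
  simp only [inner, mul_add (Cmat _ _ _ _), Finset.sum_add_distrib,
    Finset.mul_sum (Finset.univ : Finset (Fin N))]
  rw [Finset.sum_comm, Fin.sum_univ_succ (fun d => (Cmat (N + 1) hn * gammaMat (N + 1)) k d * a d),
    Cmat_mul_gammaMat_zero, one_mul, add_mul, Finset.sum_mul, Finset.mul_sum]
  congr 1
  · exact Finset.sum_congr rfl fun i _ => by ring
  · refine Finset.sum_congr rfl fun d _ => ?_
    rw [Cmat_mul_gammaMat_succ]
    have h := key (d.val + 1)
    push_cast at h ⊢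
    rw [mul_right_comm, ← h, Finset.sum_mul]
    exact Finset.sum_congr rfl fun i _ => by ring

theorem isUnit_det_gammaMat (n : ℕ) : IsUnit (gammaMat n).det := by
  have h : (gammaMat n).BlockTriangular id := fun i j hij => by
    have : j.val < i.val := hij
    simp only [gammaMat]
    rw [if_neg (by omega), if_neg (by omega)]
  rw [Matrix.det_of_isUpperTriangular h]
  simp [gammaMat]

theorem mode23_mul {I1 I2 I3 J : ℕ} (M2 N2 : Matrix (Fin I2) (Fin I2) ℝ)
    (M3 N3 : Matrix (Fin I3) (Fin I3) ℝ) (T : Fin I1 → Fin I2 → Fin I3 → Fin J → ℝ) :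
    mode23 M2 M3 (mode23 N2 N3 T) = mode23 (M2 * N2) (M3 * N3) T := by
  have h {K2 K3 : ℕ} (P2 : Matrix (Fin K2) (Fin K2) ℝ) (P3 : Matrix (Fin K3) (Fin K3) ℝ)
      (S : Fin I1 → Fin K2 → Fin K3 → Fin J → ℝ) (i1 : Fin I1) (l : Fin J) :
      (Matrix.of fun k2 k3 => mode23 P2 P3 S i1 k2 k3 l) =
        P2 * (Matrix.of fun k2 k3 => S i1 k2 k3 l) * P3ᵀ := by
    ext k2 k3
    simp only [Matrix.of_apply, mode23, Matrix.mul_apply, Matrix.transpose_apply, Finset.sum_mul]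
    rw [Finset.sum_comm]
    exact Finset.sum_congr rfl fun _ _ => Finset.sum_congr rfl fun _ _ => by ring
  funext i1 k2 k3 l
  have e : (Matrix.of fun k2 k3 => mode23 M2 M3 (mode23 N2 N3 T) i1 k2 k3 l) =
      Matrix.of fun k2 k3 => mode23 (M2 * N2) (M3 * N3) T i1 k2 k3 l := by
    simp only [h, Matrix.transpose_mul, Matrix.mul_assoc]
  exact congrFun (congrFun e k2) k3

/-- The two-dimensional convolution of `a` with the reflective extension of `x`. -/
noncomputable def reflConv₂ {I2 I3 : ℕ} (a x : Fin I2 → Fin I3 → ℝ) (i2 : Fin I2) (i3 : Fin I3) :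
    ℝ :=
  ∑ j2 ∈ Finset.Icc (((i2.val : ℤ) + 1) - I2 + 1) (((i2.val : ℤ) + 1) + I2 - 1),
  ∑ j3 ∈ Finset.Icc (((i3.val : ℤ) + 1) - I3 + 1) (((i3.val : ℤ) + 1) + I3 - 1),
    getN (fun m2 => getN (a m2) (((i3.val : ℤ) + 1) - j3).natAbs)
      (((i2.val : ℤ) + 1) - j2).natAbs *
    reflGet (fun m2 => reflGet (x m2) j3) j2

theorem starc4_eq_sum_reflConv₂ {I1 I2 I3 J I5 : ℕ}
    (A : Fin I1 → Fin I2 → Fin I3 → Fin J → ℝ) (X : Fin J → Fin I2 → Fin I3 → Fin I5 → ℝ)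
    (i1 : Fin I1) (i2 : Fin I2) (i3 : Fin I3) (i5 : Fin I5) :
    starc4 A X i1 i2 i3 i5 = ∑ l : Fin J,
      reflConv₂ (fun m2 m3 => mode23 (gammaMat I2)⁻¹ (gammaMat I3)⁻¹ A i1 m2 m3 l)
        (fun m2 m3 => X l m2 m3 i5) i2 i3 := by
  unfold reflConv₂
  rw [Finset.sum_comm]
  exact Finset.sum_congr rfl fun j2 _ => Finset.sum_comm

theorem Cmat_reflConv₂ {I2 I3 : ℕ} (h2 : 1 ≤ I2) (h3 : 1 ≤ I3)
    (a x : Fin I2 → Fin I3 → ℝ) (k2 : Fin I2) (k3 : Fin I3) :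
    ∑ i2 : Fin I2, ∑ i3 : Fin I3, Cmat I2 h2 k2 i2 * Cmat I3 h3 k3 i3 *
        reflConv₂ a x i2 i3 =
      (∑ m2, ∑ m3, (Cmat I2 h2 * gammaMat I2) k2 m2 * (Cmat I3 h3 * gammaMat I3) k3 m3 * a m2 m3) *
        ∑ m2, ∑ m3, Cmat I2 h2 k2 m2 * Cmat I3 h3 k3 m3 * x m2 m3 := by
  calc
    _ = ∑ i3 : Fin I3, Cmat I3 h3 k3 i3 *
        ∑ j3 ∈ Finset.Icc (((i3.val : ℤ) + 1) - I3 + 1) (((i3.val : ℤ) + 1) + I3 - 1),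
        ∑ i2 : Fin I2, Cmat I2 h2 k2 i2 *
        ∑ j2 ∈ Finset.Icc (((i2.val : ℤ) + 1) - I2 + 1) (((i2.val : ℤ) + 1) + I2 - 1),
          getN (fun m2 => getN (a m2) (((i3.val : ℤ) + 1) - j3).natAbs)
            (((i2.val : ℤ) + 1) - j2).natAbs *
          reflGet (fun m2 => reflGet (x m2) j3) j2 := by
      rw [Finset.sum_comm]
      refine Finset.sum_congr rfl fun i3 _ => ?_
      rw [Finset.sum_comm, Finset.mul_sum]
      refine Finset.sum_congr rfl fun i2 _ => ?_
      rw [← Finset.mul_sum, reflConv₂, Finset.sum_comm]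
      ring
    _ = _ := by
      simp only [Cmat_reflConv, ← getN_sum, ← reflGet_sum]
      congr 1 <;>
      · simp only [Finset.mul_sum]
        rw [Finset.sum_comm]
        exact Finset.sum_congr rfl fun _ _ => Finset.sum_congr rfl fun _ _ => by ring

/-- The `⋆_c`-product of 4-order tensors is computed slice-wise in the cosine
domain: if `Y = A ⋆_c X` and `Ā, X̄, Ȳ` are obtained by applying `C` (of sizes
`I2` and `I3`) along modes 2 and 3 of `A, X, Y`, then for all `i2, i3`,
`Ȳ[:,i2,i3,:] = Ā[:,i2,i3,:]·X̄[:,i2,i3,:]` (a matrix product). -/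
theorem starc4_cosine_slicewise (I1 I2 I3 J I5 : ℕ) (h2 : 1 ≤ I2) (h3 : 1 ≤ I3)
    (A : Fin I1 → Fin I2 → Fin I3 → Fin J → ℝ)
    (X : Fin J → Fin I2 → Fin I3 → Fin I5 → ℝ) :
    ∀ (i2 : Fin I2) (i3 : Fin I3) (i1 : Fin I1) (i5 : Fin I5),
      mode23 (Cmat I2 h2) (Cmat I3 h3) (starc4 A X) i1 i2 i3 i5 =
        ∑ l : Fin J, mode23 (Cmat I2 h2) (Cmat I3 h3) A i1 i2 i3 l *
          mode23 (Cmat I2 h2) (Cmat I3 h3) X l i2 i3 i5 := by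
  intro i2 i3 i1 i5
  have hA : mode23 (Cmat I2 h2) (Cmat I3 h3) A =
      mode23 (Cmat I2 h2 * gammaMat I2) (Cmat I3 h3 * gammaMat I3)
        (mode23 (gammaMat I2)⁻¹ (gammaMat I3)⁻¹ A) := by
    rw [mode23_mul, Matrix.mul_nonsing_inv_cancel_right _ _ (isUnit_det_gammaMat I2),
      Matrix.mul_nonsing_inv_cancel_right _ _ (isUnit_det_gammaMat I3)]
  rw [hA, mode23]
  simp only [starc4_eq_sum_reflConv₂, Finset.mul_sum (Finset.univ : Finset (Fin J))]
  rw [Finset.sum_congr rfl fun m2 _ => Finset.sum_comm, Finset.sum_comm]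
  exact Finset.sum_congr rfl fun l _ => Cmat_reflConv₂ h2 h3 _ (fun m2 m3 => X l m2 m3 i5) i2 i3
end
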